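/- Let Λ be a finite type with decidable equality and a distinguished element 0 ∈ Λ. Let S : Matrix Λ Λ ℂ be an invertible matrix, let C : Matrix Λ Λ ℂ, and let N : Λ → Λ → Λ → ℂ satisfy: (i) for all λ, ν ∈ Λ, N λ ν 0 = 1 if ν = λ and N λ ν 0 = 0 otherwise; (ii) for all λ, μ, ρ ∈ Λ, S μ ρ · C λ μ = ∑_{ν ∈ Λ} N λ ν ρ · S μ ν. Then for every μ ∈ Λ, S μ 0 ≠ 0, and for all λ, μ ∈ Λ, C λ μ = S μ λ / S μ 0. -/

import Mathlib

theorem stmt_6 (Λ : Type*) [Fintype Λ] [DecidableEq Λ] [Zero Λ]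
    (S C : Matrix Λ Λ ℂ) (hS : IsUnit S) (N : Λ → Λ → Λ → ℂ)
    (hN0 : ∀ l ν : Λ, N l ν 0 = if ν = l then 1 else 0)
    (hrel : ∀ l μ ρ : Λ, S μ ρ * C l μ = ∑ ν : Λ, N l ν ρ * S μ ν) :
    (∀ μ : Λ, S μ 0 ≠ 0) ∧ ∀ l μ : Λ, C l μ = S μ l / S μ 0 := by
  have hzero : ∀ l μ : Λ, S μ 0 * C l μ = S μ l := fun l μ => by
    simp [hrel, hN0]
  have hne : ∀ μ : Λ, S μ 0 ≠ 0 := fun μ hμ => by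
    have hdet : S.det = 0 :=
      Matrix.det_eq_zero_of_row_eq_zero μ fun l => by rw [← hzero l μ, hμ, zero_mul]
    exact ((Matrix.isUnit_iff_isUnit_det S).mp hS).ne_zero hdet
  exact ⟨hne, fun l μ => by rw [← hzero l μ, mul_div_cancel_left₀ _ (hne μ)]⟩
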